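/- Let a, r, a₀ ∈ ℍ[ℚ₂, 2, 5] with N(a) ≠ 0, 1 − r ≠ 0, and ‖N(a₀)‖ < 2^(−4)·‖N(a)‖·‖N(1 − r)‖². Then there exists a nonzero c ∈ ℚ₂ with N((1 − r)·a·star(1 − r) + a₀) = N(a)·c². (This is the norm computation showing that the axis s = (1−r)s_m − s₀ of a generating simple rotation satisfies N(h(s,s)) ∈ N(a_m)·(ℚ₂*)² whenever |a₀|·|a_m|⁻¹/|1−r|² < |4|.) -/

import Mathlib

open Quaternion

noncomputable section

/-- `D` is the quaternion algebra `ℍ[ℚ₂, 2, 5]` with `i² = 2`, `j² = 5`, `i·j = -j·i`;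
this is the unique quaternion division algebra over `ℚ₂`. -/
abbrev D : Type := ℍ[ℚ_[2], 2, 5]

/-- The basis quaternion `i`. -/
def qi : D := ⟨0, 1, 0, 0⟩

/-- The basis quaternion `j`. -/
def qj : D := ⟨0, 0, 1, 0⟩

/-- `ω = (1 + j)/2`. -/
def qω : D := ⟨1/2, 0, 1/2, 0⟩

/-- The reduced norm `N(q) = q · (star q)` (as a scalar). -/
def qN (q : D) : ℚ_[2] := (q * star q).re

/-- The reduced trace `T(q) = q + star q = 2·q.re` (as a scalar). -/
def qT (q : D) : ℚ_[2] := 2 * q.re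


theorem qN_eq (q : D) : qN q = q.re ^ 2 - 2 * q.imI ^ 2 - 5 * q.imJ ^ 2 + 10 * q.imK ^ 2 := by
  simp [qN]
  ring

theorem qN_mul (p q : D) : qN (p * q) = qN p * qN q := by
  simp only [qN_eq, QuaternionAlgebra.re_mul, QuaternionAlgebra.imI_mul,
    QuaternionAlgebra.imJ_mul, QuaternionAlgebra.imK_mul]
  ring

theorem qN_star (q : D) : qN (star q) = qN q := by
  simp [qN_eq]

theorem qN_smul (c : ℚ_[2]) (q : D) : qN (c • q) = c ^ 2 * qN q := by
  simp [qN_eq]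
  ring

theorem qN_add (p q : D) : qN (p + q) = qN p + 2 * (star p * q).re + qN q := by
  simp [qN_eq]
  ring

theorem norm_two : ‖(2 : ℚ_[2])‖ = 1 / 2 := by
  have := Padic.norm_p (p := 2)
  norm_num at this ⊢
  exact this

theorem unit_sq (u : ℤ_[2]) (hu : ‖u‖ = 1) : ‖u ^ 2 - 1‖ ≤ 1 / 8 := by
  have h : u ^ 2 - 1 ∈ (Ideal.span {(2 : ℤ_[2]) ^ 3} : Ideal ℤ_[2]) := by
    have := PadicInt.ker_toZModPow (p := 2) 3
    push_cast at this
    rw [← this, RingHom.mem_ker]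
    have hu' : IsUnit (PadicInt.toZModPow (p := 2) 3 u) := (PadicInt.isUnit_iff.2 hu).map _
    rw [map_sub, map_pow, map_one]
    generalize PadicInt.toZModPow (p := 2) 3 u = y at hu'
    obtain ⟨z, rfl⟩ := hu'
    have : ∀ z w : ZMod 8, z * w = 1 → z ^ 2 - 1 = 0 := by decide
    exact this _ _ z.mul_inv
  have := (PadicInt.norm_le_pow_iff_mem_span_pow (p := 2) (u ^ 2 - 1) 3).2 (by exact_mod_cast h)
  refine this.trans ?_
  norm_num [zpow_neg]

theorem sq_of_near (e : ℚ_[2]) (he : ‖e‖ < 1 / 4) : ∃ s : ℚ_[2], s ≠ 0 ∧ 1 + e = s ^ 2 := by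
  let e' : ℤ_[2] := ⟨e, by linarith⟩
  have h2 : ‖(2 : ℤ_[2])‖ = 1 / 2 := by
    rw [PadicInt.norm_def]; exact_mod_cast norm_two
  have := hensels_lemma (p := 2) (F := (Polynomial.X ^ 2 - Polynomial.C (1 + e') : Polynomial ℤ_[2]))
    (a := (1 : ℤ_[2])) (by
      have he' : ‖e'‖ < 1 / 4 := he
      simp
      norm_num
      have h2' : ‖(2 : ℤ_[2])‖ ^ 2 = 1 / 4 := by rw [h2]; norm_num
      exact he'.trans_eq h2'.symm)
  obtain ⟨z, hz, -⟩ := this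
  simp at hz
  have hz' : z ^ 2 = 1 + e' := by linear_combination hz
  have hz2 : (z : ℚ_[2]) ^ 2 = 1 + e := by
    have := congrArg (fun t : ℤ_[2] => (t : ℚ_[2])) hz'
    rw [PadicInt.coe_pow, PadicInt.coe_add, PadicInt.coe_one] at this
    exact this
  refine ⟨z, ?_, hz2.symm⟩
  intro h0
  rw [h0] at hz2
  have : e = -1 := by linear_combination -hz2
  rw [this] at he
  norm_num at he

theorem norm_add_max {x y : ℚ_[2]} (h : ‖x‖ ≠ ‖y‖) : ‖x + y‖ = max ‖x‖ ‖y‖ :=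
  Padic.add_eq_max_of_ne h

theorem norm_five : ‖(5 : ℚ_[2])‖ = 1 := by
  have h := norm_add_max (x := (1 : ℚ_[2])) (y := 2 ^ 2) (by rw [norm_pow, norm_two]; norm_num)
  rw [norm_pow, norm_two] at h
  norm_num at h
  exact h

theorem formA (x z : ℚ_[2]) : ∃ t : ℚ_[2], ‖x ^ 2 - 5 * z ^ 2‖ = ‖t‖ ^ 2 ∧ ‖x‖ ≤ 2 * ‖t‖ := by
  have h5 : ‖-(5 * z ^ 2)‖ = ‖z‖ ^ 2 := by
    rw [norm_neg, norm_mul, norm_five, norm_pow, one_mul]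
  by_cases hxz : ‖x‖ = ‖z‖
  · by_cases hz : z = 0
    · subst hz
      refine ⟨0, ?_⟩
      have : x = 0 := by simpa using hxz
      simp [this]
    · have hzn : ‖z‖ ≠ 0 := norm_ne_zero_iff.2 hz
      have hu : ‖x / z‖ = 1 := by rw [norm_div, hxz, div_self hzn]
      have h8 : ‖(x / z) ^ 2 - 1‖ ≤ 1 / 8 := by
        have := unit_sq ⟨x / z, hu.le⟩ hu
        exact this
      have h4 : ‖(-(2 ^ 2) : ℚ_[2])‖ = 1 / 4 := by
        rw [norm_neg, norm_pow, norm_two]; norm_num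
      have hs := norm_add_max (x := (x / z) ^ 2 - 1) (y := -(2 ^ 2)) (by rw [h4]; linarith)
      rw [h4, max_eq_right (by linarith)] at hs
      refine ⟨2 * z, ?_, ?_⟩
      · have : x ^ 2 - 5 * z ^ 2 = z ^ 2 * ((x / z) ^ 2 - 1 + -(2 ^ 2)) := by
          field_simp
          ring
        rw [this, norm_mul, hs, norm_mul, norm_two, norm_pow]
        ring
      · rw [norm_mul, norm_two, hxz]; linarith
  · have hne : ‖x ^ 2‖ ≠ ‖-(5 * z ^ 2)‖ := by
      rw [h5, norm_pow]
      intro h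
      exact hxz ((sq_eq_sq₀ (norm_nonneg _) (norm_nonneg _)).1 h)
    have hm := norm_add_max hne
    rw [← sub_eq_add_neg, h5, norm_pow] at hm
    have hx := norm_nonneg x
    have hz := norm_nonneg z
    rcases le_total ‖x‖ ‖z‖ with h | h
    · refine ⟨z, ?_, by linarith⟩
      rw [hm, max_eq_right]; gcongr
    · refine ⟨x, ?_, by linarith⟩
      rw [hm, max_eq_left]; gcongr

theorem parity (s t : ℚ_[2]) (ht : t ≠ 0) : ‖t‖ ^ 2 ≠ 1 / 2 * ‖s‖ ^ 2 := by
  intro h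
  have hs : s ≠ 0 := by
    rintro rfl
    simp at h
    exact ht h
  have e1 := Padic.norm_eq_zpow_neg_valuation ht
  have e2 := Padic.norm_eq_zpow_neg_valuation hs
  rw [e1, e2] at h
  push_cast at h
  have h' : (2 : ℝ) ^ (-t.valuation * 2) = (2 : ℝ) ^ (-1 + -s.valuation * 2) := by
    rw [zpow_add₀ (by norm_num), zpow_mul, zpow_mul]
    norm_num at h ⊢
    exact_mod_cast h
  have := zpow_right_injective₀ (by norm_num : (0 : ℝ) < 2) (by norm_num) h'
  omega

theorem trace_bound (q : D) (h : ‖qN q‖ < 1 / 16) : ‖q.re‖ ≤ 1 / 4 := by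
  obtain ⟨t, ht, hx⟩ := formA q.re q.imJ
  obtain ⟨s, hs, -⟩ := formA q.imI q.imK
  by_cases ht0 : t = 0
  · subst ht0
    simp at hx
    simp [hx]
  have hB : ‖-(2 * (q.imI ^ 2 - 5 * q.imK ^ 2))‖ = 1 / 2 * ‖s‖ ^ 2 := by
    rw [norm_neg, norm_mul, hs, norm_two]
  have hm := norm_add_max (x := q.re ^ 2 - 5 * q.imJ ^ 2)
    (y := -(2 * (q.imI ^ 2 - 5 * q.imK ^ 2))) (by rw [hB, ht]; exact parity s t ht0)
  have hN : q.re ^ 2 - 5 * q.imJ ^ 2 + -(2 * (q.imI ^ 2 - 5 * q.imK ^ 2)) = qN q := by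
    rw [qN_eq]; ring
  rw [hN, ht] at hm
  have h1 : ‖t‖ ^ 2 < 1 / 16 := lt_of_le_of_lt (by rw [hm]; exact le_max_left _ _) h
  have h2 : ‖t‖ < 1 / 4 := by
    nlinarith [norm_nonneg t]
  have h3 : ‖t‖ ≤ 1 / 8 := by
    have := (Padic.norm_le_pow_iff_norm_lt_pow_add_one (p := 2) t (-3)).2 (by norm_num; linarith)
    refine this.trans ?_
    norm_num
  linarith

/-- If `N(a) ≠ 0`, `1 - r ≠ 0` and `‖N(a₀)‖ < 2^(-4)·‖N(a)‖·‖N(1-r)‖²`, then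
`N((1-r)·a·star(1-r) + a₀)` lies in `N(a)·(ℚ₂*)²`. -/
theorem stmt_7 (a r a₀ : D) (ha : qN a ≠ 0) (hr : 1 - r ≠ 0)
    (ha₀ : ‖qN a₀‖ < (2 : ℝ) ^ (-4 : ℤ) * ‖qN a‖ * ‖qN (1 - r)‖ ^ 2) :
    ∃ c : ℚ_[2], c ≠ 0 ∧ qN ((1 - r) * a * star (1 - r) + a₀) = qN a * c ^ 2 := by
  set M : ℚ_[2] := qN a * qN (1 - r) ^ 2 with hM
  have hn : qN (1 - r) ≠ 0 := by
    intro h0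
    rw [h0] at ha₀
    simp at ha₀
    exact absurd ha₀ (not_lt.2 (norm_nonneg _))
  have hM0 : M ≠ 0 := mul_ne_zero ha (pow_ne_zero _ hn)
  have hMn : 0 < ‖M‖ := norm_pos_iff.2 hM0
  set b : D := (1 - r) * a * star (1 - r) with hb
  have hNb : qN b = M := by
    rw [hb, qN_mul, qN_mul, qN_star, hM]; ring
  have hlt : ‖qN a₀ / M‖ < 1 / 16 := by
    rw [norm_div, div_lt_iff₀ hMn, hM, norm_mul, norm_pow]
    refine ha₀.trans_le (le_of_eq ?_)
    norm_num
    ring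
  have hq : qN (M⁻¹ • (star b * a₀)) = qN a₀ / M := by
    rw [qN_smul, qN_mul, qN_star, hNb]; field_simp
  have htr := trace_bound (M⁻¹ • (star b * a₀)) (by rw [hq]; exact hlt)
  rw [QuaternionAlgebra.re_smul, smul_eq_mul] at htr
  obtain ⟨s, hs0, hs⟩ := sq_of_near (2 * (M⁻¹ * (star b * a₀).re) + qN a₀ / M) (by
    refine (Padic.nonarchimedean _ _).trans_lt (max_lt ?_ (by linarith))
    rw [norm_mul, norm_two]
    linarith)
  refine ⟨qN (1 - r) * s, mul_ne_zero hn hs0, ?_⟩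
  rw [mul_pow, ← hs, qN_add, hNb, ← mul_assoc, ← hM]
  field_simp
  ring
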